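/- Let L be a bounded distributive lattice, n ≥ 1, and f : L^n → L. Then f is a Sugeno integral (i.e., f = S_μ for some L-valued fuzzy measure μ on [n]) if and only if f is a weighted lattice polynomial function satisfying f(e_∅) = 0 and f(e_{[n]}) = 1. -/

import Mathlib

/-- Weighted lattice polynomial (w.l.p.) functions from `L^n` to `L`: the smallest
class containing all coordinate projections and all constant functions, and closed
under pointwise `⊓` and `⊔`. -/
inductive IsWLP {L : Type*} [Lattice L] {n : ℕ} : ((Fin n → L) → L) → Prop
  | proj (k : Fin n) : IsWLP (fun x => x k)
  | const (c : L) : IsWLP (fun _ => c)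
  | inf {p q : (Fin n → L) → L} : IsWLP p → IsWLP q → IsWLP (fun x => p x ⊓ q x)
  | sup {p q : (Fin n → L) → L} : IsWLP p → IsWLP q → IsWLP (fun x => p x ⊔ q x)

/-- The characteristic vector `e_S` of `S ⊆ [n]`: its `i`-th component is `1` (top)
if `i ∈ S` and `0` (bottom) otherwise. -/
def charVec (L : Type*) [Lattice L] [BoundedOrder L] {n : ℕ} (S : Finset (Fin n)) :
    Fin n → L :=
  fun i => if i ∈ S then ⊤ else ⊥

namespace IsWLP

variable {L : Type*} {n : ℕ}

theorem monotone [Lattice L] {p : (Fin n → L) → L} (hp : IsWLP p) : Monotone p := by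
  induction hp with
  | proj k => exact fun _ _ h => h k
  | const c => exact monotone_const
  | inf _ _ hp hq => exact hp.inf hq
  | sup _ _ hp hq => exact hp.sup hq

theorem finset_inf [Lattice L] [OrderTop L] {ι : Type*} (s : Finset ι)
    {p : ι → (Fin n → L) → L} (hp : ∀ i, IsWLP (p i)) :
    IsWLP (fun x => s.inf fun i => p i x) := by
  classical
  induction s using Finset.induction_on with
  | empty => simpa using IsWLP.const ⊤
  | insert i s _ ih => simpa only [Finset.inf_insert] using (hp i).inf ih

theorem finset_sup [Lattice L] [OrderBot L] {ι : Type*} (s : Finset ι)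
    {p : ι → (Fin n → L) → L} (hp : ∀ i, IsWLP (p i)) :
    IsWLP (fun x => s.sup fun i => p i x) := by
  classical
  induction s using Finset.induction_on with
  | empty => simpa using IsWLP.const ⊥
  | insert i s _ ih => simpa only [Finset.sup_insert] using (hp i).sup ih

end IsWLP

section

variable {L : Type*} {n : ℕ}

theorem charVec_mono [Lattice L] [BoundedOrder L] : Monotone (charVec L (n := n)) := by
  intro S T h i
  by_cases hS : i ∈ S
  · simp [charVec, hS, h hS]
  · simp [charVec, hS]

variable [DistribLattice L] [BoundedOrder L]

theorem IsWLP.charVec_inf_le {p : (Fin n → L) → L} (hp : IsWLP p) (S : Finset (Fin n))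
    (x : Fin n → L) : p (charVec L S) ⊓ S.inf x ≤ p x := by
  induction hp with
  | proj k =>
    by_cases hk : k ∈ S
    · exact inf_le_right.trans (Finset.inf_le hk)
    · simp [charVec, hk]
  | const c => exact inf_le_left
  | inf _ _ hp hq =>
    exact le_inf ((inf_le_inf_right _ inf_le_left).trans hp)
      ((inf_le_inf_right _ inf_le_right).trans hq)
  | sup _ _ hp hq =>
    rw [inf_sup_right]
    exact sup_le_sup hp hq

theorem IsWLP.le_sup_charVec_inf {p : (Fin n → L) → L} (hp : IsWLP p) (x : Fin n → L) :
    p x ≤ Finset.univ.sup fun S : Finset (Fin n) => p (charVec L S) ⊓ S.inf x := by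
  induction hp with
  | proj k =>
    refine le_trans ?_ (Finset.le_sup (Finset.mem_univ {k}))
    simp [charVec]
  | const c =>
    refine le_trans ?_ (Finset.le_sup (Finset.mem_univ ∅))
    simp
  | inf hp hq ihp ihq =>
    refine (inf_le_inf ihp ihq).trans ?_
    rw [Finset.sup_inf_sup]
    refine Finset.sup_le fun ⟨S, T⟩ _ => le_trans ?_ (Finset.le_sup (Finset.mem_univ (S ∪ T)))
    rw [Finset.inf_union, inf_inf_inf_comm]
    exact inf_le_inf_right _ (inf_le_inf
      (hp.monotone (charVec_mono Finset.subset_union_left))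
      (hq.monotone (charVec_mono Finset.subset_union_right)))
  | sup _ _ ihp ihq =>
    exact sup_le
      (ihp.trans (Finset.sup_mono_fun fun _ _ => inf_le_inf_right _ le_sup_left))
      (ihq.trans (Finset.sup_mono_fun fun _ _ => inf_le_inf_right _ le_sup_right))

/-- Disjunctive normal form of a weighted lattice polynomial function. -/
theorem IsWLP.eq_sup_charVec_inf {p : (Fin n → L) → L} (hp : IsWLP p) (x : Fin n → L) :
    p x = Finset.univ.sup fun S : Finset (Fin n) => p (charVec L S) ⊓ S.inf x :=
  (hp.le_sup_charVec_inf x).antisymm (Finset.sup_le fun S _ => hp.charVec_inf_le S x)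

end

/-- A function `f : L^n → L` is a Sugeno integral (with respect to some `L`-valued
fuzzy measure on `[n]`) iff it is a w.l.p. function with `f (e_∅) = 0` and
`f (e_[n]) = 1`. -/
theorem sugeno_integral_iff_wlp_with_boundary_values
    {L : Type*} [DistribLattice L] [BoundedOrder L] {n : ℕ} (hn : 1 ≤ n)
    (f : (Fin n → L) → L) :
    (∃ μ : Finset (Fin n) → L,
        (∀ S T : Finset (Fin n), S ⊆ T → μ S ≤ μ T) ∧
        μ ∅ = ⊥ ∧ μ Finset.univ = ⊤ ∧
        ∀ x : Fin n → L,
          f x = Finset.univ.sup (fun S : Finset (Fin n) => μ S ⊓ S.inf x)) ↔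
      (IsWLP f ∧ f (charVec L ∅) = ⊥ ∧ f (charVec L Finset.univ) = ⊤) := by
  constructor
  · rintro ⟨μ, -, h_empty, h_univ, hf⟩
    refine ⟨?_, ?_, ?_⟩
    · rw [funext hf]
      exact IsWLP.finset_sup _ fun S =>
        (IsWLP.const (μ S)).inf (IsWLP.finset_inf S IsWLP.proj)
    · rw [hf, Finset.sup_eq_bot_iff]
      intro S _
      obtain rfl | ⟨i, hi⟩ := S.eq_empty_or_nonempty
      · simp [h_empty]
      · exact le_bot_iff.mp (inf_le_right.trans ((Finset.inf_le hi).trans (by simp [charVec])))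
    · rw [hf, eq_top_iff]
      refine le_trans ?_ (Finset.le_sup (Finset.mem_univ Finset.univ))
      simp [h_univ, charVec]
  · rintro ⟨hf, h_empty, h_univ⟩
    exact ⟨fun S => f (charVec L S), fun S T h => hf.monotone (charVec_mono h), h_empty, h_univ,
      hf.eq_sup_charVec_inf⟩
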